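/- arXiv:2602.02710 — 4 statements merged into one kernel-verified Lean document; each statement's English description precedes it below -/
import Mathlib

section
/- (Estimator–objective equivalence, main theorem.) Define the estimator ĝ on Z^N by ĝ(z₁,…,z_N) = (1/K) ∑_{i=1}^N r(zᵢ) S(zᵢ) if K ≥ 1 and ĝ = 0 if K = 0, where K = #{i : zᵢ ∈ A}. Then the expectation of ĝ over the N-fold product of the measure with mass function m θ₀ equals ∑_{k=1}^N (1/k) · d/dθ[1 − (1 − p θ)^k] at θ₀; equivalently, it equals (∑_{k=1}^N (1 − p(θ₀))^{k−1}) · p'(θ₀). -/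
open Finset in
lemma eoe_coord {Z : Type*} [Fintype Z] [DecidableEq Z] (w f : Z → ℝ) (A : Finset Z) (n : ℕ)
    (i : Fin (n + 1)) :
    ∑ z : Fin (n + 1) → Z, (∏ j, w (z j)) *
      ((∑ j, if z j ∈ A then (1 : ℝ) else 0)⁻¹ * ((if z i ∈ A then (1 : ℝ) else 0) * f (z i)))
    = (∑ y : Fin n → Z, (∏ j, w (y j)) * (1 + ∑ j, if y j ∈ A then (1 : ℝ) else 0)⁻¹) *
      ∑ a ∈ A, w a * f a := by
  rw [← (Fin.insertNthEquiv (fun _ => Z) i).sum_comp, Fintype.sum_prod_type, mul_comm,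
    ← Finset.sum_filter_add_sum_filter_not univ (fun a => a ∈ A)]
  have h2 : ∑ x with x ∉ A, ∑ y : Fin n → Z,
      (∏ j, w (((Fin.insertNthEquiv (fun _ => Z) i) (x, y)) j)) *
      ((∑ j, if ((Fin.insertNthEquiv (fun _ => Z) i) (x, y)) j ∈ A then (1 : ℝ) else 0)⁻¹ *
        ((if ((Fin.insertNthEquiv (fun _ => Z) i) (x, y)) i ∈ A then (1 : ℝ) else 0) *
          f (((Fin.insertNthEquiv (fun _ => Z) i) (x, y)) i))) = 0 := by
    refine Finset.sum_eq_zero fun x hx => Finset.sum_eq_zero fun y _ => ?_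
    have : x ∉ A := by simpa using hx
    simp [this]
  rw [h2, add_zero, Finset.filter_mem_eq_inter, Finset.univ_inter, Finset.sum_mul]
  refine Finset.sum_congr rfl fun x hx => ?_
  rw [Finset.mul_sum]
  refine Finset.sum_congr rfl fun y _ => ?_
  rw [Fin.prod_univ_succAbove _ i, Fin.sum_univ_succAbove _ i]
  simp only [Fin.insertNthEquiv_apply, Fin.insertNth_apply_same, Fin.insertNth_apply_succAbove,
    hx, if_true]
  ring

open Finset in
lemma eoe_lin {Z : Type*} [Fintype Z] [DecidableEq Z] (w f : Z → ℝ) (A : Finset Z) (n : ℕ) :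
    ∑ z : Fin (n + 1) → Z, (∏ j, w (z j)) *
      ((∑ j, if z j ∈ A then (1 : ℝ) else 0)⁻¹ *
        ∑ i, (if z i ∈ A then (1 : ℝ) else 0) * f (z i))
    = ((n + 1 : ℝ) * ∑ y : Fin n → Z,
        (∏ j, w (y j)) * (1 + ∑ j, if y j ∈ A then (1 : ℝ) else 0)⁻¹) *
      ∑ a ∈ A, w a * f a := by
  simp only [Finset.mul_sum (s := (univ : Finset (Fin (n+1))))]
  rw [Finset.sum_comm]
  simp only [eoe_coord, Finset.sum_const, Finset.card_univ, Fintype.card_fin, nsmul_eq_mul]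
  push_cast
  ring

open Finset in
lemma eoe_one {Z : Type*} [Fintype Z] [DecidableEq Z] (w : Z → ℝ) (hw : ∑ z, w z = 1)
    (A : Finset Z) (n : ℕ) :
    ∑ z : Fin n → Z, (∏ j, w (z j)) *
      ((∑ j, if z j ∈ A then (1 : ℝ) else 0)⁻¹ *
        ∑ i, (if z i ∈ A then (1 : ℝ) else 0) * 1)
    = 1 - (1 - ∑ a ∈ A, w a) ^ n := by
  have hq : 1 - ∑ a ∈ A, w a = ∑ a, w a * (if a ∈ A then 0 else 1) := by
    rw [← hw, sub_eq_iff_eq_add, ← Finset.univ_inter A, ← Finset.filter_mem_eq_inter,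
      Finset.sum_filter, ← Finset.sum_add_distrib]
    refine Finset.sum_congr rfl fun a _ => ?_
    by_cases h : a ∈ A <;> simp [h, hw]
  have h1 : (1 : ℝ) = ∑ z : Fin n → Z, ∏ j, w (z j) := by
    rw [← Fintype.sum_pow, hw, one_pow]
  rw [hq, Fintype.sum_pow]
  nth_rewrite 4 [h1]
  rw [← Finset.sum_sub_distrib]
  refine Finset.sum_congr rfl fun z _ => ?_
  rw [Finset.prod_mul_distrib]
  by_cases h : ∃ i, z i ∈ A
  · obtain ⟨i, hi⟩ := h
    have hp : ∏ j, (if z j ∈ A then (0 : ℝ) else 1) = 0 :=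
      Finset.prod_eq_zero (Finset.mem_univ i) (by simp [hi])
    have hs : 0 < ∑ j, (if z j ∈ A then (1 : ℝ) else 0) :=
      Finset.sum_pos' (fun j _ => by split_ifs <;> norm_num) ⟨i, Finset.mem_univ i, by simp [hi]⟩
    simp only [mul_one]
    rw [hp, inv_mul_cancel₀ hs.ne']
    ring
  · push Not at h
    simp [h]

open Finset in
/-- Estimator–objective equivalence: the expectation of the success-averaged
score estimator `ĝ` over `N` i.i.d. rollouts equals the truncated maximum
likelihood gradient `∑_{k=1}^N (1/k) d/dθ[1 - (1 - p θ)^k]` at `θ₀`, which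
equals `(∑_{k=1}^N (1 - p θ₀)^{k-1}) · p'(θ₀)`. -/
theorem estimator_objective_equivalence
    (Z : Type*) [Fintype Z] [Nonempty Z] [DecidableEq Z] (θ₀ : ℝ) (m : ℝ → Z → ℝ)
    (hpos : ∀ θ z, 0 < m θ z)
    (hsum : ∀ θ, ∑ z, m θ z = 1)
    (hdiff : ∀ z, DifferentiableAt ℝ (fun θ => m θ z) θ₀)
    (A : Finset Z) (N : ℕ) (hN : 1 ≤ N) :
    (∑ z : Fin N → Z, (∏ i, m θ₀ (z i)) *
        (if 1 ≤ (univ.filter (fun i => z i ∈ A)).card then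
          (1 / ((univ.filter (fun i => z i ∈ A)).card : ℝ)) *
            ∑ i, (if z i ∈ A then (1 : ℝ) else 0) *
              deriv (fun θ => Real.log (m θ (z i))) θ₀
         else 0))
      = ∑ k ∈ Finset.range N,
          (1 / ((k : ℝ) + 1)) *
            deriv (fun θ => 1 - (1 - ∑ z ∈ A, m θ z) ^ (k + 1)) θ₀ ∧
    (∑ k ∈ Finset.range N,
        (1 / ((k : ℝ) + 1)) *
          deriv (fun θ => 1 - (1 - ∑ z ∈ A, m θ z) ^ (k + 1)) θ₀)
      = (∑ k ∈ Finset.range N, (1 - ∑ z ∈ A, m θ₀ z) ^ k) *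
          deriv (fun θ => ∑ z ∈ A, m θ z) θ₀ := by
  have hp : HasDerivAt (fun θ => ∑ z ∈ A, m θ z) (∑ z ∈ A, deriv (fun θ => m θ z) θ₀) θ₀ :=
    HasDerivAt.fun_sum fun z _ => (hdiff z).hasDerivAt
  have h2 : (∑ k ∈ Finset.range N,
        (1 / ((k : ℝ) + 1)) *
          deriv (fun θ => 1 - (1 - ∑ z ∈ A, m θ z) ^ (k + 1)) θ₀)
      = (∑ k ∈ Finset.range N, (1 - ∑ z ∈ A, m θ₀ z) ^ k) *
          deriv (fun θ => ∑ z ∈ A, m θ z) θ₀ := by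
    rw [Finset.sum_mul]
    refine Finset.sum_congr rfl fun k _ => ?_
    have := (((hp.const_sub 1).fun_pow (k + 1)).const_sub 1).deriv
    rw [this, hp.deriv]
    have hk : (k : ℝ) + 1 ≠ 0 := by positivity
    push_cast
    field_simp
  refine ⟨?_, h2⟩
  rw [h2, hp.deriv]
  obtain ⟨n, rfl⟩ : ∃ n, N = n + 1 := ⟨N - 1, by omega⟩
  have hS : ∑ a ∈ A, m θ₀ a * deriv (fun θ => Real.log (m θ a)) θ₀
      = ∑ z ∈ A, deriv (fun θ => m θ z) θ₀ := by
    refine Finset.sum_congr rfl fun a _ => ?_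
    rw [((hdiff a).hasDerivAt.log (hpos θ₀ a).ne').deriv]
    field_simp [(hpos θ₀ a).ne']
  have hL := eoe_lin (m θ₀) (fun z => deriv (fun θ => Real.log (m θ z)) θ₀) A n
  have hL1 := eoe_lin (m θ₀) (fun _ => 1) A n
  rw [eoe_one (m θ₀) (hsum θ₀) A (n + 1)] at hL1
  simp only [mul_one] at hL1
  rw [hS] at hL
  have hE : (∑ z : Fin (n + 1) → Z, (∏ i, m θ₀ (z i)) *
        (if 1 ≤ (univ.filter (fun i => z i ∈ A)).card then
          (1 / ((univ.filter (fun i => z i ∈ A)).card : ℝ)) *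
            ∑ i, (if z i ∈ A then (1 : ℝ) else 0) *
              deriv (fun θ => Real.log (m θ (z i))) θ₀
         else 0)) = ∑ z : Fin (n + 1) → Z, (∏ j, m θ₀ (z j)) *
      ((∑ j, if z j ∈ A then (1 : ℝ) else 0)⁻¹ *
        ∑ i, (if z i ∈ A then (1 : ℝ) else 0) * deriv (fun θ => Real.log (m θ (z i))) θ₀) := by
    refine Finset.sum_congr rfl fun z _ => ?_
    rw [Finset.sum_boole, one_div]
    split_ifs with h
    · rfl
    · have : (univ.filter (fun i => z i ∈ A)).card = 0 := by omega
      rw [this]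
      simp
  rw [hE, hL]
  rcases A.eq_empty_or_nonempty with rfl | hA
  · simp
  · have hpp : 0 < ∑ a ∈ A, m θ₀ a := Finset.sum_pos (fun a _ => hpos θ₀ a) hA
    congr 1
    apply mul_right_cancel₀ hpp.ne'
    rw [← hL1]
    have := geom_sum_mul (1 - ∑ a ∈ A, m θ₀ a) (n + 1)
    linarith
end

section
/- (Conditional-average identity for i.i.d. samples.) Let g : Z → ℝ be any function and suppose p = μ(A) > 0, where μ is the probability mass function on Z. For (z₁,…,z_N) distributed according to the N-fold product of μ, with K = #{i : zᵢ ∈ A}, the expectation of the random variable equal to (1/K) ∑_{i : zᵢ ∈ A} g(zᵢ) when K ≥ 1 and equal to 0 when K = 0 is (1 − (1 − p)^N) · (1/p) · ∑_{z∈A} μ(z) g(z); that is, it equals the probability of at least one success times the success-conditioned mean of g. -/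
open Finset in
lemma cai_fiber (Z : Type*) [Fintype Z] [DecidableEq Z] (μ : Z → ℝ) (hsum : ∑ z, μ z = 1)
    (A : Finset Z) (g : Z → ℝ) (N : ℕ) (S : Finset (Fin N)) (i : Fin N) (hi : i ∈ S) :
    (∑ z ∈ Fintype.piFinset (fun j => if j ∈ S then A else Aᶜ),
      (∏ j, μ (z j)) * g (z i)) * (∑ z ∈ A, μ z)
      = (∑ z ∈ A, μ z * g z) *
        ((∑ z ∈ A, μ z) ^ S.card * (1 - ∑ z ∈ A, μ z) ^ (N - S.card)) := by
  have hq : ∑ z ∈ Aᶜ, μ z = 1 - ∑ z ∈ A, μ z := by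
    rw [← hsum, ← Finset.sum_add_sum_compl A]; ring
  have h1 : ∀ z : Fin N → Z, (∏ j, μ (z j)) * g (z i)
      = ∏ j, (μ (z j) * if j = i then g (z j) else 1) := by
    intro z
    rw [Finset.prod_mul_distrib]
    simp
  have h2 : ∏ j, (∑ z ∈ (if j ∈ S then A else Aᶜ), μ z)
      = (∑ z ∈ A, μ z) ^ S.card * (1 - ∑ z ∈ A, μ z) ^ (N - S.card) := by
    have : ∀ j, (∑ z ∈ (if j ∈ S then A else Aᶜ), μ z)
        = if j ∈ S then ∑ z ∈ A, μ z else 1 - ∑ z ∈ A, μ z := by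
      intro j
      split_ifs
      · rfl
      · exact hq
    simp_rw [this]
    rw [Finset.prod_ite]
    have e : (univ.filter (fun j => j ∉ S)) = Sᶜ := by ext; simp
    rw [e]
    simp [Finset.card_compl]
  simp_rw [h1]
  rw [← Finset.prod_univ_sum (fun j => if j ∈ S then A else Aᶜ)
    (fun j z => μ z * if j = i then g z else 1), ← h2,
    ← Finset.mul_prod_erase univ _ (mem_univ i), ← Finset.mul_prod_erase univ _ (mem_univ i)]
  have h3 : ∏ j ∈ univ.erase i, (∑ z ∈ (if j ∈ S then A else Aᶜ), μ z * if j = i then g z else 1)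
      = ∏ j ∈ univ.erase i, ∑ z ∈ (if j ∈ S then A else Aᶜ), μ z := by
    refine Finset.prod_congr rfl fun j hj => ?_
    simp [Finset.ne_of_mem_erase hj]
  rw [h3]
  simp only [hi, if_true]
  ring

open Finset in
/-- Conditional-average identity for i.i.d. samples: for any `g : Z → ℝ` and
`p = μ(A) > 0`, the expectation of the average of `g` over the successful
coordinates (and `0` when there is no success) equals the probability of at
least one success times the success-conditioned mean of `g`. -/
theorem conditional_average_identity
    (Z : Type*) [Fintype Z] [Nonempty Z] [DecidableEq Z] (μ : Z → ℝ)
    (hpos : ∀ z, 0 < μ z)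
    (hsum : ∑ z, μ z = 1)
    (A : Finset Z) (g : Z → ℝ) (N : ℕ) (hN : 1 ≤ N)
    (hp : 0 < ∑ z ∈ A, μ z) :
    (∑ z : Fin N → Z, (∏ i, μ (z i)) *
        (if 1 ≤ (univ.filter (fun i => z i ∈ A)).card then
          (1 / ((univ.filter (fun i => z i ∈ A)).card : ℝ)) *
            ∑ i ∈ univ.filter (fun i => z i ∈ A), g (z i)
         else 0))
      = (1 - (1 - ∑ z ∈ A, μ z) ^ N) * (1 / ∑ z ∈ A, μ z) *
          ∑ z ∈ A, μ z * g z := by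
  rw [← Finset.sum_fiberwise univ (fun z : Fin N → Z => univ.filter (fun i => z i ∈ A))]
  set p := ∑ z ∈ A, μ z with hpdef
  set m := ∑ z ∈ A, μ z * g z with hm
  have key : ∀ S : Finset (Fin N),
      (∑ z : Fin N → Z with univ.filter (fun i => z i ∈ A) = S, (∏ i, μ (z i)) *
        (if 1 ≤ (univ.filter (fun i => z i ∈ A)).card then
          (1 / ((univ.filter (fun i => z i ∈ A)).card : ℝ)) *
            ∑ i ∈ univ.filter (fun i => z i ∈ A), g (z i)
         else 0))
      = m / p * (p ^ S.card * (1 - p) ^ (N - S.card)) -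
        (if S = ∅ then m / p * (1 - p) ^ N else 0) := by
    intro S
    by_cases hS : S = ∅
    · subst hS
      rw [Finset.sum_eq_zero]
      · simp
      · intro z hz
        rw [(Finset.mem_filter.mp hz).2]
        simp
    have hc : 1 ≤ S.card := Finset.card_pos.mpr (Finset.nonempty_iff_ne_empty.mpr hS)
    have hc' : (S.card : ℝ) ≠ 0 := by positivity
    have hset : (univ.filter (fun z : Fin N → Z => univ.filter (fun i => z i ∈ A) = S))
        = Fintype.piFinset (fun j => if j ∈ S then A else Aᶜ) := by
      ext z
      simp only [mem_filter, mem_univ, true_and, Fintype.mem_piFinset, Finset.ext_iff]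
      refine forall_congr' fun j => ?_
      by_cases hj : j ∈ S <;> simp [hj]
    have e : ∀ i ∈ S, (∑ z ∈ Fintype.piFinset (fun j => if j ∈ S then A else Aᶜ),
        (∏ j, μ (z j)) * g (z i)) = m / p * (p ^ S.card * (1 - p) ^ (N - S.card)) := by
      intro i hi
      have := cai_fiber Z μ hsum A g N S i hi
      rw [div_mul_eq_mul_div, eq_div_iff hp.ne']
      exact this
    rw [if_neg hS, sub_zero]
    calc _ = ∑ z ∈ Fintype.piFinset (fun j => if j ∈ S then A else Aᶜ),
          (1 / (S.card : ℝ)) * ∑ i ∈ S, (∏ j, μ (z j)) * g (z i) := by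
          rw [← hset]
          refine Finset.sum_congr rfl fun z hz => ?_
          rw [(Finset.mem_filter.mp hz).2, if_pos hc, ← Finset.mul_sum]
          ring
      _ = _ := by
          rw [← Finset.mul_sum, Finset.sum_comm, Finset.sum_congr rfl e, Finset.sum_const,
            nsmul_eq_mul]
          field_simp
  rw [Finset.sum_congr rfl fun S _ => key S, Finset.sum_sub_distrib, ← Finset.mul_sum]
  have hb := Fin.sum_pow_mul_eq_add_pow (n := N) p (1 - p)
  rw [hb]
  simp
  ring
end

section
/- (The control variate preserves unbiasedness.) Define the variance-reduced estimator g̃ on Z^N by g̃(z₁,…,z_N) = ∑_{i=1}^N (r(zᵢ)/K − 1/N) S(zᵢ) when K = #{i : zᵢ ∈ A} ≥ 1, and g̃ = −(1/N) ∑_{i=1}^N S(zᵢ) when K = 0. Then the expectation of g̃ over the N-fold product of the measure with mass function m θ₀ equals ∑_{k=1}^N (1/k) · d/dθ[1 − (1 − p θ)^k] at θ₀, the same truncated maximum likelihood gradient as the uncorrected estimator. -/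
/-- Split off coordinate `i` in an expectation over the product. -/
lemma cv_split {Z : Type*} [Fintype Z] (w : Z → ℝ) (n : ℕ) (i : Fin (n + 1))
    (G : (Fin (n + 1) → Z) → ℝ) :
    ∑ z : Fin (n + 1) → Z, (∏ j, w (z j)) * G z =
      ∑ x : Z, ∑ y : Fin n → Z, (w x * ∏ j, w (y j)) * G (i.insertNth x y) := by
  rw [← (Fin.insertNthEquiv (fun _ => Z) i).sum_comp, Fintype.sum_prod_type]
  refine Finset.sum_congr rfl fun x _ => Finset.sum_congr rfl fun y _ => ?_
  simp [Fin.insertNthEquiv, Fin.prod_univ_succAbove _ i]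

lemma cv_card {Z : Type*} [DecidableEq Z] (A : Finset Z) (n : ℕ) (i : Fin (n + 1))
    (x : Z) (y : Fin n → Z) :
    (Finset.univ.filter (fun j => (i.insertNth x y : Fin (n + 1) → Z) j ∈ A)).card =
      (if x ∈ A then 1 else 0) + (Finset.univ.filter (fun j => y j ∈ A)).card := by
  rw [Finset.card_filter, Finset.card_filter, Fin.sum_univ_succAbove _ i]
  simp

lemma cv_main {Z : Type*} [Fintype Z] [DecidableEq Z] (w : Z → ℝ) (A : Finset Z) (n : ℕ)
    (f : Z → ℝ) :
    ∑ z : Fin (n + 1) → Z, (∏ j, w (z j)) *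
      ∑ i, (if z i ∈ A then (1 : ℝ) else 0) /
        ((Finset.univ.filter (fun j => z j ∈ A)).card : ℝ) * f (z i) =
    ((n : ℝ) + 1) * (∑ x ∈ A, w x * f x) *
      ∑ y : Fin n → Z, (∏ j, w (y j)) *
        (1 / (1 + ((Finset.univ.filter (fun j => y j ∈ A)).card : ℝ))) := by
  simp_rw [Finset.mul_sum (s := (Finset.univ : Finset (Fin (n + 1))))]
  rw [Finset.sum_comm]
  have h : ∀ i : Fin (n + 1), ∑ z : Fin (n + 1) → Z, (∏ j, w (z j)) *
      ((if z i ∈ A then (1 : ℝ) else 0) /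
        ((Finset.univ.filter (fun j => z j ∈ A)).card : ℝ) * f (z i)) =
      (∑ x ∈ A, w x * f x) *
      ∑ y : Fin n → Z, (∏ j, w (y j)) *
        (1 / (1 + ((Finset.univ.filter (fun j => y j ∈ A)).card : ℝ))) := by
    intro i
    rw [cv_split w n i (fun z => (if z i ∈ A then (1 : ℝ) else 0) /
        ((Finset.univ.filter (fun j => z j ∈ A)).card : ℝ) * f (z i))]
    have e : ∑ x ∈ A, w x * f x = ∑ x, if x ∈ A then w x * f x else 0 := by
      simp
    rw [e, Finset.sum_mul_sum]
    refine Finset.sum_congr rfl fun x _ => Finset.sum_congr rfl fun y _ => ?_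
    simp only [cv_card, Fin.insertNth_apply_same]
    split_ifs
    · push_cast
      ring
    · simp
  rw [Finset.sum_congr rfl fun i _ => h i]
  simp
  ring

lemma cv_score {Z : Type*} [Fintype Z] (w : Z → ℝ) (n : ℕ) (f : Z → ℝ)
    (h0 : ∑ x, w x * f x = 0) :
    ∑ z : Fin (n + 1) → Z, (∏ j, w (z j)) * ∑ i, f (z i) = 0 := by
  simp_rw [Finset.mul_sum]
  rw [Finset.sum_comm]
  refine Finset.sum_eq_zero fun i _ => ?_
  rw [cv_split w n i (fun z => f (z i))]
  have : ∀ x : Z, ∑ y : Fin n → Z, (w x * ∏ j, w (y j)) *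
      f ((i.insertNth x y : Fin (n + 1) → Z) i) =
      (w x * f x) * ∑ y : Fin n → Z, ∏ j, w (y j) := by
    intro x
    rw [Finset.mul_sum]
    refine Finset.sum_congr rfl fun y _ => ?_
    simp only [Fin.insertNth_apply_same]
    ring
  rw [Finset.sum_congr rfl fun x _ => this x, ← Finset.sum_mul, h0, zero_mul]

lemma cv_prob {Z : Type*} [Fintype Z] [DecidableEq Z] (w : Z → ℝ) (hw : ∑ x, w x = 1)
    (A : Finset Z) (n : ℕ) :
    ∑ z : Fin n → Z, (∏ j, w (z j)) *
      ∑ i, (if z i ∈ A then (1 : ℝ) else 0) /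
        ((Finset.univ.filter (fun j => z j ∈ A)).card : ℝ) * 1 =
    1 - (1 - ∑ x ∈ A, w x) ^ n := by
  have e : 1 - ∑ x ∈ A, w x = ∑ x, w x * (if x ∈ A then 0 else 1) := by
    have : ∑ x ∈ A, w x = ∑ x, w x * (if x ∈ A then 1 else 0) := by simp
    rw [this, ← hw, ← Finset.sum_sub_distrib]
    refine Finset.sum_congr rfl fun x _ => ?_
    split_ifs <;> simp [hw]
  have e1 : (1 : ℝ) = ∑ z : Fin n → Z, ∏ j, w (z j) := by
    rw [← Fintype.sum_pow, hw, one_pow]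
  rw [e, Fintype.sum_pow]
  conv_rhs => enter [1]; rw [e1]
  rw [← Finset.sum_sub_distrib]
  refine Finset.sum_congr rfl fun z _ => ?_
  rw [Finset.prod_mul_distrib]
  simp only [mul_one]
  rw [← Finset.sum_div, Finset.sum_boole]
  by_cases hz : ∃ j, z j ∈ A
  · obtain ⟨j, hj⟩ := hz
    have hc : ((Finset.univ.filter (fun j => z j ∈ A)).card : ℝ) ≠ 0 := by
      rw [Nat.cast_ne_zero]
      exact Finset.card_ne_zero_of_mem (a := j) (by simp [hj])
    rw [div_self hc, Finset.prod_eq_zero (f := fun j => if z j ∈ A then (0 : ℝ) else 1)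
      (Finset.mem_univ j) (by simp [hj])]
    ring
  · push Not at hz
    simp [hz]

open Finset in
/-- The control variate preserves unbiasedness: the variance-reduced estimator
`g̃(z) = ∑ᵢ (r(zᵢ)/K − 1/N) S(zᵢ)` when `K ≥ 1` and `g̃ = −(1/N) ∑ᵢ S(zᵢ)`
when `K = 0` has the same expectation as the uncorrected estimator, namely the
truncated maximum likelihood gradient `∑_{k=1}^N (1/k) d/dθ[1 − (1 − p θ)^k]`
at `θ₀`. -/
theorem control_variate_preserves_unbiasedness
    (Z : Type*) [Fintype Z] [Nonempty Z] [DecidableEq Z] (θ₀ : ℝ) (m : ℝ → Z → ℝ)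
    (hpos : ∀ θ z, 0 < m θ z)
    (hsum : ∀ θ, ∑ z, m θ z = 1)
    (hdiff : ∀ z, DifferentiableAt ℝ (fun θ => m θ z) θ₀)
    (A : Finset Z) (N : ℕ) (hN : 1 ≤ N) :
    (∑ z : Fin N → Z, (∏ i, m θ₀ (z i)) *
        (if 1 ≤ (univ.filter (fun i => z i ∈ A)).card then
          ∑ i, ((if z i ∈ A then (1 : ℝ) else 0) /
                  ((univ.filter (fun i => z i ∈ A)).card : ℝ) - 1 / (N : ℝ)) *
            deriv (fun θ => Real.log (m θ (z i))) θ₀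
         else
          -(1 / (N : ℝ)) * ∑ i, deriv (fun θ => Real.log (m θ (z i))) θ₀))
      = ∑ k ∈ Finset.range N,
          (1 / ((k : ℝ) + 1)) *
            deriv (fun θ => 1 - (1 - ∑ z ∈ A, m θ z) ^ (k + 1)) θ₀ := by
  obtain ⟨n, rfl⟩ : ∃ n, N = n + 1 := ⟨N - 1, by omega⟩
  have hS : ∀ z, m θ₀ z * deriv (fun θ => Real.log (m θ z)) θ₀ =
      deriv (fun θ => m θ z) θ₀ := by
    intro z
    rw [deriv.log (hdiff z) (hpos θ₀ z).ne']
    field_simp [(hpos θ₀ z).ne']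
  set S : Z → ℝ := fun z => deriv (fun θ => Real.log (m θ z)) θ₀ with hSdef
  have h0 : ∑ z, m θ₀ z * S z = 0 := by
    rw [Finset.sum_congr rfl fun z _ => hS z, ← deriv_fun_sum fun z _ => hdiff z]
    simp [hsum]
  have hp : HasDerivAt (fun θ => ∑ z ∈ A, m θ z) (∑ z ∈ A, m θ₀ z * S z) θ₀ := by
    rw [Finset.sum_congr rfl fun z _ => hS z]
    exact HasDerivAt.fun_sum fun z _ => (hdiff z).hasDerivAt
  have hR : ∀ k : ℕ, (1 / ((k : ℝ) + 1)) *
      deriv (fun θ => 1 - (1 - ∑ z ∈ A, m θ z) ^ (k + 1)) θ₀ =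
      (1 - ∑ z ∈ A, m θ₀ z) ^ k * ∑ z ∈ A, m θ₀ z * S z := by
    intro k
    rw [(((hp.const_sub 1).fun_pow (k + 1)).const_sub 1).deriv]
    have : (k : ℝ) + 1 ≠ 0 := by positivity
    push_cast
    field_simp
  rw [Finset.sum_congr rfl fun k _ => hR k, ← Finset.sum_mul]
  have hL : ∀ z : Fin (n + 1) → Z, (∏ i, m θ₀ (z i)) *
        (if 1 ≤ (univ.filter (fun i => z i ∈ A)).card then
          ∑ i, ((if z i ∈ A then (1 : ℝ) else 0) /
                  ((univ.filter (fun i => z i ∈ A)).card : ℝ) - 1 / ((n + 1 : ℕ) : ℝ)) *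
            S (z i)
         else
          -(1 / ((n + 1 : ℕ) : ℝ)) * ∑ i, S (z i)) =
      (∏ i, m θ₀ (z i)) * (∑ i, (if z i ∈ A then (1 : ℝ) else 0) /
                  ((univ.filter (fun i => z i ∈ A)).card : ℝ) * S (z i)) -
      (1 / ((n + 1 : ℕ) : ℝ)) * ((∏ i, m θ₀ (z i)) * ∑ i, S (z i)) := by
    intro z
    split_ifs with h
    · simp_rw [sub_mul]
      rw [Finset.sum_sub_distrib, ← Finset.mul_sum]
      ring
    · have h' : (univ.filter (fun i => z i ∈ A)).card = 0 := by omega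
      rw [h']
      simp
      ring
  refine (Finset.sum_congr rfl fun z _ => hL z).trans ?_
  rw [Finset.sum_sub_distrib, ← Finset.mul_sum, cv_score (m θ₀) n S h0, mul_zero, sub_zero,
    cv_main (m θ₀) A n S]
  rcases A.eq_empty_or_nonempty with rfl | hA
  · simp
  have hpp : 0 < ∑ z ∈ A, m θ₀ z := Finset.sum_pos (fun z _ => hpos θ₀ z) hA
  have h1 := cv_main (m θ₀) A n (fun _ => 1)
  rw [cv_prob (m θ₀) (hsum θ₀) A (n + 1)] at h1
  have h2 := mul_neg_geom_sum (1 - ∑ z ∈ A, m θ₀ z) (n + 1)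
  rw [← h2] at h1
  simp only [mul_one, sub_sub_cancel] at h1
  have h3 := mul_left_cancel₀ hpp.ne' (h1.trans (by rw [mul_comm ((n : ℝ) + 1), mul_assoc]))
  rw [h3]
  ring
end

section
/- (Population-level GRPO gradient.) Suppose 0 < p(θ₀) < 1 and write p = p(θ₀). Then the population GRPO gradient ∑_{z∈Z} (m θ₀ z) · ((r(z) − p)/√(p(1 − p))) · S(z) equals p'(θ₀)/√(p(1 − p)); that is, GRPO's Z-normalized advantage induces the weight function w(p) = 1/√(p(1 − p)) applied to the pass-rate gradient. -/
/-- Population-level GRPO gradient: with `p = p(θ₀)` and `0 < p < 1`, the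
population GRPO gradient `∑ z, m θ₀ z · ((r z − p)/√(p(1−p))) · S z` equals
`p'(θ₀)/√(p(1−p))`. -/
theorem grpo_population_gradient
    (Z : Type*) [Fintype Z] [Nonempty Z] [DecidableEq Z] (θ₀ : ℝ) (m : ℝ → Z → ℝ)
    (hpos : ∀ θ z, 0 < m θ z)
    (hsum : ∀ θ, ∑ z, m θ z = 1)
    (hdiff : ∀ z, DifferentiableAt ℝ (fun θ => m θ z) θ₀)
    (A : Finset Z)
    (hp0 : 0 < ∑ z ∈ A, m θ₀ z) (hp1 : ∑ z ∈ A, m θ₀ z < 1) :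
    (∑ z, m θ₀ z *
        (((if z ∈ A then (1 : ℝ) else 0) - ∑ z ∈ A, m θ₀ z) /
          Real.sqrt ((∑ z ∈ A, m θ₀ z) * (1 - ∑ z ∈ A, m θ₀ z))) *
        deriv (fun θ => Real.log (m θ z)) θ₀)
      = deriv (fun θ => ∑ z ∈ A, m θ z) θ₀ /
          Real.sqrt ((∑ z ∈ A, m θ₀ z) * (1 - ∑ z ∈ A, m θ₀ z)) := by
  have hS : ∀ z, deriv (fun θ => Real.log (m θ z)) θ₀
      = deriv (fun θ => m θ z) θ₀ / m θ₀ z :=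
    fun z => ((hdiff z).hasDerivAt.log (hpos θ₀ z).ne').deriv
  have hA : ∀ B : Finset Z, deriv (fun θ => ∑ z ∈ B, m θ z) θ₀
      = ∑ z ∈ B, deriv (fun θ => m θ z) θ₀ :=
    fun B => (HasDerivAt.fun_sum fun z _ => (hdiff z).hasDerivAt).deriv
  have h0 : ∑ z, deriv (fun θ => m θ z) θ₀ = 0 := by
    rw [← hA Finset.univ]
    simp [hsum]
  rw [hA A]
  generalize (∑ z ∈ A, m θ₀ z) = p
  generalize Real.sqrt (p * (1 - p)) = s
  have hterm : ∀ z, m θ₀ z * (((if z ∈ A then (1 : ℝ) else 0) - p) / s) *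
      deriv (fun θ => Real.log (m θ z)) θ₀
      = ((if z ∈ A then deriv (fun θ => m θ z) θ₀ else 0)
          - p * deriv (fun θ => m θ z) θ₀) / s := by
    intro z
    have hz := (hpos θ₀ z).ne'
    rw [hS z]
    have h1 : m θ₀ z * (deriv (fun θ => m θ z) θ₀ / m θ₀ z)
        = deriv (fun θ => m θ z) θ₀ := mul_div_cancel₀ _ hz
    rw [mul_right_comm, h1]
    split_ifs <;> ring
  rw [Finset.sum_congr rfl fun z _ => hterm z, ← Finset.sum_div,
    Finset.sum_sub_distrib, ← Finset.mul_sum, h0]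
  simp
end
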